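/- Let S be a densely defined, closed, symmetric operator in H with S ≥ ε I (ε > 0). Then the j-th minimax value of the Friedrichs extension S_F is bounded above by the j-th minimax value of the reduced Krein–von Neumann operator Ŝ_K: ε ≤ μ_{S_F,j} ≤ μ_{Ŝ_K,j} for all j ∈ ℕ. -/

import Mathlib

open Filter Topology

noncomputable section

variable {H : Type*} [NormedAddCommGroup H] [InnerProductSpace ℂ H] [CompleteSpace H]

local notation "⟪" x ", " y "⟫" => @inner ℂ _ _ x y

/-- Standing hypothesis: `S` is densely defined, closed, symmetric, and `S ≥ ε`. -/
structure StandingHyp (S : H →ₗ.[ℂ] H) (ε : ℝ) : Prop where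
  dense : Dense (S.domain : Set H)
  closed : S.IsClosed
  symmetric : ∀ u v : S.domain, ⟪(S u : H), (v : H)⟫ = ⟪(u : H), (S v : H)⟫
  pos : 0 < ε
  lower : ∀ u : S.domain, ε * ‖(u : H)‖ ^ 2 ≤ (⟪(u : H), (S u : H)⟫).re

/-- Krein–von Neumann extension, via the Ando–Nishio intrinsic description. -/
def IsKreinVonNeumannExtension (S Sk : H →ₗ.[ℂ] H) : Prop :=
  Sk ≤ S.adjoint ∧
  ∀ v : H, v ∈ Sk.domain ↔ ∃ hv : v ∈ S.adjoint.domain, ∃ f : ℕ → S.domain,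
    Tendsto (fun j => (S (f j) : H)) atTop (nhds (S.adjoint ⟨v, hv⟩)) ∧
    ∀ δ : ℝ, 0 < δ → ∃ N : ℕ, ∀ j ≥ N, ∀ k ≥ N,
      ‖⟪((f j - f k : S.domain) : H), (S (f j - f k) : H)⟫‖ < δ

/-- Friedrichs extension, via Freudenthal's intrinsic description. -/
def IsFriedrichsExtension (S Sf : H →ₗ.[ℂ] H) : Prop :=
  Sf ≤ S.adjoint ∧
  ∀ v : H, v ∈ Sf.domain ↔ v ∈ S.adjoint.domain ∧ ∃ f : ℕ → S.domain,
    Tendsto (fun j => ((f j : H))) atTop (nhds v) ∧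
    ∀ δ : ℝ, 0 < δ → ∃ N : ℕ, ∀ j ≥ N, ∀ k ≥ N,
      ‖⟪((f j - f k : S.domain) : H), (S (f j - f k) : H)⟫‖ < δ

/-- The kernel of a partially defined operator, as a submodule of `H`. -/
def pKer (A : H →ₗ.[ℂ] H) : Submodule ℂ H :=
  (LinearMap.ker A.toFun).map A.domain.subtype

/-- `q` is the orthogonal projection of `u` onto `Kᗮ`. -/
def IsOrthProjOn (K : Submodule ℂ H) (u q : H) : Prop :=
  q ∈ Kᗮ ∧ u - q ∈ Kᗮᗮ
/-- The `j`-th minimax value of a (partially defined) operator `A`, computed over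
`j`-dimensional subspaces of `dom A ∩ D`. -/
noncomputable def minimaxValue (A : H →ₗ.[ℂ] H) (D : Set H) (j : ℕ) : ℝ :=
  sInf { c : ℝ | ∃ M : Submodule ℂ H, (M : Set H) ⊆ (A.domain : Set H) ∩ D ∧
    Module.finrank ℂ M = j ∧
    ∀ u ∈ M, ∀ hu : u ∈ A.domain, (⟪u, (A ⟨u, hu⟩ : H)⟫).re ≤ c * ‖u‖ ^ 2 }


lemma StandingHyp.norm_le {S : H →ₗ.[ℂ] H} {ε : ℝ} (hS : StandingHyp S ε) (u : S.domain) :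
    ε * ‖(u : H)‖ ≤ ‖S u‖ := by
  have h1 := hS.lower u
  have h2 : (⟪(u : H), (S u : H)⟫).re ≤ ‖(u : H)‖ * ‖S u‖ :=
    (Complex.re_le_norm _).trans (norm_inner_le_norm _ _)
  rcases (norm_nonneg (u : H)).eq_or_lt with h | h
  · rw [← h]; simp
  · have : ‖(u : H)‖ * (ε * ‖(u : H)‖) ≤ ‖(u : H)‖ * ‖S u‖ := by nlinarith
    exact le_of_mul_le_mul_left this h

lemma StandingHyp.le_adjoint {S : H →ₗ.[ℂ] H} {ε : ℝ} (hS : StandingHyp S ε) : S ≤ S.adjoint :=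
  LinearPMap.IsFormalAdjoint.le_adjoint hS.dense (fun u v => hS.symmetric u v)

lemma StandingHyp.range_closed {S : H →ₗ.[ℂ] H} {ε : ℝ} (hS : StandingHyp S ε)
    (f : ℕ → S.domain) (y : H) (h : Tendsto (fun j => (S (f j) : H)) atTop (nhds y)) :
    ∃ g : S.domain, S g = y := by
  have hc : CauchySeq (fun j => (S (f j) : H)) := h.cauchySeq
  have hc2 : CauchySeq (fun j => (f j : H)) := by
    rw [Metric.cauchySeq_iff] at hc ⊢
    intro δ hδ
    obtain ⟨N, hN⟩ := hc (ε * δ) (mul_pos hS.pos hδ)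
    refine ⟨N, fun m hm n hn => ?_⟩
    have h1 := hN m hm n hn
    have h2 := hS.norm_le (f m - f n)
    rw [LinearPMap.map_sub] at h2
    rw [dist_eq_norm] at h1 ⊢
    have h3 : ε * ‖(f m : H) - f n‖ < ε * δ := lt_of_le_of_lt h2 h1
    exact lt_of_mul_lt_mul_left h3 hS.pos.le
  obtain ⟨x, hx⟩ := cauchySeq_tendsto_of_complete hc2
  have hmem : (x, y) ∈ S.graph := by
    have hcl : IsClosed (S.graph : Set (H × H)) := hS.closed
    refine hcl.mem_of_tendsto (hx.prodMk_nhds h) (Eventually.of_forall fun n => ?_)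
    exact S.mem_graph (f n)
  rw [LinearPMap.mem_graph_iff] at hmem
  obtain ⟨g, _, hg⟩ := hmem
  exact ⟨g, hg⟩

lemma StandingHyp.friedrichs_lower {S Sf : H →ₗ.[ℂ] H} {ε : ℝ} (hS : StandingHyp S ε)
    (hF : IsFriedrichsExtension S Sf) (v : Sf.domain) :
    ε * ‖(v : H)‖ ^ 2 ≤ (⟪(v : H), (Sf v : H)⟫).re := by
  obtain ⟨hv, f, hf, hq⟩ := (hF.2 v).1 v.2
  have hv' : Sf v = S.adjoint ⟨v, hv⟩ := hF.1.2 rfl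
  rw [hv']
  set w := S.adjoint ⟨v, hv⟩ with hw
  have hadj : ∀ g : S.domain, ⟪(g : H), w⟫ = ⟪S g, (v : H)⟫ := by
    intro g
    have := LinearPMap.adjoint_isFormalAdjoint hS.dense ⟨v, hv⟩ g
    rw [← inner_conj_symm, ← inner_conj_symm (S g), hw, this]
  refine le_of_forall_pos_sub_le ?_
  intro δ hδ
  obtain ⟨N, hN⟩ := hq (2 * δ) (by linarith)
  have key : ∀ n ≥ N, ∀ m ≥ N,
      (ε * ‖(f n : H)‖ ^ 2 + ε * ‖(f m : H)‖ ^ 2 - 2 * δ) / 2 ≤ (⟪S (f n), (f m : H)⟫).re := by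
    intro n hn m hm
    have h1 := (Complex.re_le_norm _).trans_lt (hN n hn m hm)
    have h2 := hS.lower (f n)
    have h3 := hS.lower (f m)
    have h4 : (⟪((f n - f m : S.domain) : H), (S (f n - f m) : H)⟫).re =
        (⟪(f n : H), S (f n)⟫).re + (⟪(f m : H), S (f m)⟫).re
          - 2 * (⟪S (f n), (f m : H)⟫).re := by
      rw [LinearPMap.map_sub, Submodule.coe_sub, inner_sub_left, inner_sub_right, inner_sub_right]
      have a : ⟪(f n : H), S (f m)⟫ = ⟪S (f n), (f m : H)⟫ := (hS.symmetric _ _).symm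
      have b : (⟪(f m : H), S (f n)⟫).re = (⟪S (f n), (f m : H)⟫).re := by
        rw [← inner_conj_symm]; exact Complex.conj_re _
      rw [Complex.sub_re, Complex.sub_re, Complex.sub_re, a, b]; ring
    linarith
  have key2 : ∀ n ≥ N,
      (ε * ‖(f n : H)‖ ^ 2 + ε * ‖(v : H)‖ ^ 2 - 2 * δ) / 2 ≤ (⟪(f n : H), w⟫).re := by
    intro n hn
    rw [hadj]
    refine le_of_tendsto_of_tendsto (b := atTop)
      (f := fun m => (ε * ‖(f n : H)‖ ^ 2 + ε * ‖(f m : H)‖ ^ 2 - 2 * δ) / 2)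
      (g := fun m => (⟪S (f n), (f m : H)⟫).re) ?_ ?_ ?_
    · exact ((((hf.norm.pow 2).const_mul ε).const_add _).sub_const _).div_const _
    · exact (Complex.continuous_re.tendsto _).comp (tendsto_const_nhds.inner hf)
    · filter_upwards [eventually_ge_atTop N] with m hm using key n hn m hm
  have key3 : (ε * ‖(v : H)‖ ^ 2 + ε * ‖(v : H)‖ ^ 2 - 2 * δ) / 2 ≤ (⟪(v : H), w⟫).re := by
    refine le_of_tendsto_of_tendsto (b := atTop)
      (f := fun m => (ε * ‖(f m : H)‖ ^ 2 + ε * ‖(v : H)‖ ^ 2 - 2 * δ) / 2)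
      (g := fun m => (⟪(f m : H), w⟫).re) ?_ ?_ ?_
    · exact ((((hf.norm.pow 2).const_mul ε).add_const _).sub_const _).div_const _
    · exact (Complex.continuous_re.tendsto _).comp (hf.inner tendsto_const_nhds)
    · filter_upwards [eventually_ge_atTop N] with m hm using key2 m hm
  linarith

lemma StandingHyp.le_friedrichs {S Sf : H →ₗ.[ℂ] H} {ε : ℝ} (hS : StandingHyp S ε)
    (hF : IsFriedrichsExtension S Sf) : S ≤ Sf := by
  have hd : S.domain ≤ Sf.domain := fun u hu => (hF.2 u).2 ⟨hS.le_adjoint.1 hu,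
    fun _ => ⟨u, hu⟩, tendsto_const_nhds, fun δ hδ => ⟨0, fun _ _ _ _ => by simpa using hδ⟩⟩
  refine ⟨hd, fun u v huv => ?_⟩
  have h1 : S u = S.adjoint ⟨u, hS.le_adjoint.1 u.2⟩ := hS.le_adjoint.2 rfl
  have h2 : Sf v = S.adjoint ⟨u, hS.le_adjoint.1 u.2⟩ := hF.1.2 huv.symm
  rw [h1, h2]

/-- `(I - P)` restricted to the domain of `S`. -/
def redMap (S Sk : H →ₗ.[ℂ] H) : S.domain →ₗ[ℂ] H :=
  ((pKer Sk)ᗮ.starProjection : H →ₗ[ℂ] H) ∘ₗ S.domain.subtype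

lemma redMap_apply (S Sk : H →ₗ.[ℂ] H) (f : S.domain) :
    redMap S Sk f = (pKer Sk)ᗮ.starProjection (f : H) := rfl

lemma mem_pKer {A : H →ₗ.[ℂ] H} {n : H} :
    n ∈ pKer A ↔ ∃ h : n ∈ A.domain, A ⟨n, h⟩ = 0 := by
  unfold pKer
  constructor
  · rintro ⟨x, hx, rfl⟩
    exact ⟨x.2, hx⟩
  · rintro ⟨h, h0⟩
    exact ⟨⟨n, h⟩, h0, rfl⟩

lemma range_mem_orth {S Sk : H →ₗ.[ℂ] H} {ε : ℝ} (hS : StandingHyp S ε)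
    (hK : IsKreinVonNeumannExtension S Sk) (f : S.domain) : S f ∈ (pKer Sk)ᗮ := by
  rw [Submodule.mem_orthogonal]
  intro n hn
  obtain ⟨h, h0⟩ := mem_pKer.1 hn
  have h1 : Sk ⟨n, h⟩ = S.adjoint ⟨n, hK.1.1 h⟩ := hK.1.2 rfl
  have := LinearPMap.adjoint_isFormalAdjoint hS.dense ⟨n, hK.1.1 h⟩ f
  rw [← this, ← h1, h0, inner_zero_left]

lemma krein_of_adjoint {S Sk : H →ₗ.[ℂ] H}
    (hK : IsKreinVonNeumannExtension S Sk) (f : S.domain) (v : H)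
    (hv : v ∈ S.adjoint.domain) (h : S.adjoint ⟨v, hv⟩ = S f) :
    ∃ h : v ∈ Sk.domain, Sk ⟨v, h⟩ = S f := by
  have hd : v ∈ Sk.domain := (hK.2 v).2 ⟨hv, fun _ => f, by rw [h]; exact tendsto_const_nhds,
    fun δ hδ => ⟨0, fun _ _ _ _ => by simpa using hδ⟩⟩
  refine ⟨hd, ?_⟩
  rw [← h]
  exact hK.1.2 rfl

lemma redMap_spec {S Sk : H →ₗ.[ℂ] H} {ε : ℝ} (hS : StandingHyp S ε)
    (hK : IsKreinVonNeumannExtension S Sk) (f : S.domain) :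
    ∃ h : redMap S Sk f ∈ Sk.domain, Sk ⟨redMap S Sk f, h⟩ = S f := by
  have horth : ∀ g : S.domain, ⟪(f : H) - redMap S Sk f, S g⟫ = 0 := fun g =>
    Submodule.starProjection_inner_eq_zero _ _ (range_mem_orth hS hK g)
  have hx : ∀ g : S.domain, ⟪S f, (g : H)⟫ = ⟪redMap S Sk f, S g⟫ := by
    intro g
    have := horth g
    rw [inner_sub_left, sub_eq_zero] at this
    rw [← this]; exact hS.symmetric f g
  have hv : redMap S Sk f ∈ S.adjoint.domain :=
    LinearPMap.mem_adjoint_domain_of_exists _ ⟨S f, hx⟩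
  exact krein_of_adjoint hK f _ hv (LinearPMap.adjoint_apply_eq hS.dense ⟨_, hv⟩ hx)

lemma redMap_inner {S Sk : H →ₗ.[ℂ] H} {ε : ℝ} (hS : StandingHyp S ε)
    (hK : IsKreinVonNeumannExtension S Sk) (f g : S.domain) :
    ⟪redMap S Sk f, S g⟫ = ⟪(f : H), S g⟫ := by
  have : ⟪(f : H) - redMap S Sk f, S g⟫ = 0 :=
    Submodule.starProjection_inner_eq_zero _ _ (range_mem_orth hS hK g)
  rw [inner_sub_left, sub_eq_zero] at this
  exact this.symm

lemma redMap_injective {S Sk : H →ₗ.[ℂ] H} {ε : ℝ} (hS : StandingHyp S ε)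
    (hK : IsKreinVonNeumannExtension S Sk) : Function.Injective (redMap S Sk) := by
  rw [injective_iff_map_eq_zero]
  intro f hf
  have h1 := redMap_inner hS hK f f
  have h2 := hS.lower f
  rw [← h1, hf, inner_zero_left, Complex.zero_re] at h2
  have h3 : ‖(f : H)‖ ^ 2 ≤ 0 := by
    by_contra hc
    push Not at hc
    nlinarith [mul_pos hS.pos hc]
  have h4 : ‖(f : H)‖ = 0 := by nlinarith [norm_nonneg (f : H)]
  exact Subtype.ext (norm_eq_zero.1 h4)

lemma redMap_surj {S Sk : H →ₗ.[ℂ] H} {ε : ℝ} (hS : StandingHyp S ε)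
    (hK : IsKreinVonNeumannExtension S Sk) (u : H) (hu : u ∈ Sk.domain)
    (hu' : u ∈ (pKer Sk)ᗮ) : ∃ f, redMap S Sk f = u := by
  obtain ⟨hv, f, hf, -⟩ := (hK.2 u).1 hu
  obtain ⟨g, hg⟩ := hS.range_closed f _ hf
  refine ⟨g, ?_⟩
  have hgS := hS.le_adjoint.1 g.2
  have hg2 : S g = S.adjoint ⟨g, hgS⟩ := hS.le_adjoint.2 rfl
  have hn : S.adjoint ⟨(g : H) - u, sub_mem hgS hv⟩ = S 0 := by
    have : (⟨(g : H) - u, sub_mem hgS hv⟩ : S.adjoint.domain) = ⟨g, hgS⟩ - ⟨u, hv⟩ := rfl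
    rw [this, LinearPMap.map_sub, ← hg2, hg, sub_self, LinearPMap.map_zero]
  obtain ⟨hm, h0⟩ := krein_of_adjoint hK 0 _ _ hn
  have hk : (g : H) - u ∈ pKer Sk := mem_pKer.2 ⟨hm, by rw [h0, LinearPMap.map_zero]⟩
  rw [redMap_apply]
  exact Submodule.eq_starProjection_of_mem_orthogonal hu'
    (Submodule.le_orthogonal_orthogonal _ hk)

lemma not_finite_domain {S : H →ₗ.[ℂ] H} {ε : ℝ} (hS : StandingHyp S ε)
    (hdef : ∃ x : H, ∃ hx : x ∈ S.adjoint.domain, x ≠ 0 ∧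
      S.adjoint ⟨x, hx⟩ = Complex.I • x) : ¬ Module.Finite ℂ S.domain := by
  intro hfin
  obtain ⟨x, hx, hx0, hI⟩ := hdef
  have hcl : IsClosed (S.domain : Set H) := Submodule.closed_of_finiteDimensional _
  have hxS : x ∈ S.domain := by
    have := hS.dense x
    rwa [hcl.closure_eq] at this
  have h1 : S ⟨x, hxS⟩ = S.adjoint ⟨x, hx⟩ := hS.le_adjoint.2 rfl
  have h2 := hS.lower ⟨x, hxS⟩
  rw [h1, hI, inner_smul_right] at h2
  have h3 : (Complex.I * ⟪x, x⟫).re = 0 := by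
    rw [inner_self_eq_norm_sq_to_K]
    simp [← Complex.ofReal_pow]
  have h4 := norm_pos_iff.2 hx0
  have := mul_pos hS.pos (pow_pos h4 2)
  simp only at h2
  linarith

lemma exists_sub {V : Type*} [AddCommGroup V] [Module ℂ V] (h : ¬ Module.Finite ℂ V) (j : ℕ) :
    ∃ L : Submodule ℂ V, Module.Finite ℂ L ∧ Module.finrank ℂ L = j := by
  have hr : (j : Cardinal) ≤ Module.rank ℂ V := by
    have : Cardinal.aleph0 ≤ Module.rank ℂ V := by
      by_contra hc
      push Not at hc
      exact h (Module.rank_lt_aleph0_iff.1 hc)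
    exact Cardinal.natCast_le_aleph0.trans this
  obtain ⟨f, hf⟩ := Module.le_rank_iff_exists_linearMap.1 hr
  exact ⟨LinearMap.range f, inferInstance, by simp [LinearMap.finrank_range_of_inj hf]⟩

lemma krein_nonempty {S Sk : H →ₗ.[ℂ] H} {ε : ℝ} (hS : StandingHyp S ε)
    (hK : IsKreinVonNeumannExtension S Sk) (h : ¬ Module.Finite ℂ S.domain) (j : ℕ) :
    { c : ℝ | ∃ M : Submodule ℂ H,
      (M : Set H) ⊆ (Sk.domain : Set H) ∩ ((pKer Sk)ᗮ : Set H) ∧ Module.finrank ℂ M = j ∧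
      ∀ u ∈ M, ∀ hu : u ∈ Sk.domain, (⟪u, (Sk ⟨u, hu⟩ : H)⟫).re ≤ c * ‖u‖ ^ 2 }.Nonempty := by
  obtain ⟨L, hL, hLj⟩ := exists_sub h j
  have hM : L.map (redMap S Sk) ≤ Sk.domain := by
    rintro _ ⟨f, -, rfl⟩
    exact (redMap_spec hS hK f).1
  let T : L.map (redMap S Sk) →ₗ[ℂ] H := Sk.toFun ∘ₗ Submodule.inclusion hM
  refine ⟨‖LinearMap.toContinuousLinearMap T‖, L.map (redMap S Sk), ?_, ?_, ?_⟩
  · rintro u hu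
    refine ⟨hM hu, ?_⟩
    obtain ⟨f, -, rfl⟩ := hu
    exact Submodule.starProjection_apply_mem _ _
  · rw [← hLj]
    exact (Submodule.equivMapOfInjective _ (redMap_injective hS hK) L).finrank_eq.symm
  · intro u hu hu'
    have h1 : ‖Sk ⟨u, hu'⟩‖ ≤ ‖LinearMap.toContinuousLinearMap T‖ * ‖u‖ :=
      (LinearMap.toContinuousLinearMap T).le_opNorm ⟨u, hu⟩
    have h2 : (⟪u, (Sk ⟨u, hu'⟩ : H)⟫).re ≤ ‖u‖ * ‖Sk ⟨u, hu'⟩‖ :=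
      (Complex.re_le_norm _).trans (norm_inner_le_norm _ _)
    nlinarith [norm_nonneg u]

lemma exists_ne_zero_of_finrank {M : Submodule ℂ H} {j : ℕ} (hj : 1 ≤ j)
    (h : Module.finrank ℂ M = j) : ∃ u ∈ M, u ≠ 0 := by
  have hM : M ≠ ⊥ := by
    rintro rfl
    simp at h
    omega
  exact Submodule.exists_mem_ne_zero_of_ne_bot hM

/-- `ε ≤ μ_{S_F, j} ≤ μ_{Ŝ_K, j}` for all `j ≥ 1`, where `Ŝ_K` is the reduced
Krein--von Neumann operator (`S_K` restricted to `(ker S_K)ᗮ`). -/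
theorem friedrichs_minimax_le_krein_minimax
    (S Sf Sk : H →ₗ.[ℂ] H) (ε : ℝ) (hS : StandingHyp S ε)
    (hF : IsFriedrichsExtension S Sf) (hK : IsKreinVonNeumannExtension S Sk)
    -- nonzero deficiency index: `ker (S* - i) ≠ {0}`
    (hdef : ∃ x : H, ∃ hx : x ∈ S.adjoint.domain, x ≠ 0 ∧
      S.adjoint ⟨x, hx⟩ = Complex.I • x)
    (j : ℕ) (hj : 1 ≤ j) :
    ε ≤ minimaxValue Sf Set.univ j ∧
      minimaxValue Sf Set.univ j ≤ minimaxValue Sk ((pKer Sk)ᗮ : Set H) j := by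
  have hFlow : ∀ c ∈ { c : ℝ | ∃ M : Submodule ℂ H,
      (M : Set H) ⊆ (Sf.domain : Set H) ∩ Set.univ ∧ Module.finrank ℂ M = j ∧
      ∀ u ∈ M, ∀ hu : u ∈ Sf.domain, (⟪u, (Sf ⟨u, hu⟩ : H)⟫).re ≤ c * ‖u‖ ^ 2 }, ε ≤ c := by
    rintro c ⟨M, hM, hMj, hMc⟩
    obtain ⟨u, hu, hu0⟩ := exists_ne_zero_of_finrank hj hMj
    have h1 := hMc u hu (hM hu).1
    have h2 := hS.friedrichs_lower hF ⟨u, (hM hu).1⟩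
    exact le_of_mul_le_mul_right (h2.trans h1) (pow_pos (norm_pos_iff.2 hu0) 2)
  have hsub : { c : ℝ | ∃ M : Submodule ℂ H,
      (M : Set H) ⊆ (Sk.domain : Set H) ∩ ((pKer Sk)ᗮ : Set H) ∧ Module.finrank ℂ M = j ∧
      ∀ u ∈ M, ∀ hu : u ∈ Sk.domain, (⟪u, (Sk ⟨u, hu⟩ : H)⟫).re ≤ c * ‖u‖ ^ 2 } ⊆
      { c : ℝ | ∃ M : Submodule ℂ H,
      (M : Set H) ⊆ (Sf.domain : Set H) ∩ Set.univ ∧ Module.finrank ℂ M = j ∧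
      ∀ u ∈ M, ∀ hu : u ∈ Sf.domain, (⟪u, (Sf ⟨u, hu⟩ : H)⟫).re ≤ c * ‖u‖ ^ 2 } := by
    rintro c ⟨M, hM, hMj, hMc⟩
    have hform : ∀ f : S.domain, redMap S Sk f ∈ M →
        (⟪(f : H), S f⟫).re ≤ c * ‖redMap S Sk f‖ ^ 2 := by
      intro f hf
      obtain ⟨h, h'⟩ := redMap_spec hS hK f
      have := hMc _ hf h
      rwa [h', redMap_inner hS hK] at this
    have hc : 0 ≤ c := by
      obtain ⟨u, hu, hu0⟩ := exists_ne_zero_of_finrank hj hMj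
      obtain ⟨f, rfl⟩ := redMap_surj hS hK u (hM hu).1 (hM hu).2
      have h1 := (hS.lower f).trans (hform f hu)
      have h2 : 0 ≤ ε * ‖(f : H)‖ ^ 2 := mul_nonneg hS.pos.le (sq_nonneg _)
      exact nonneg_of_mul_nonneg_left (h2.trans h1) (pow_pos (norm_pos_iff.2 hu0) 2)
    refine ⟨(M.comap (redMap S Sk)).map S.domain.subtype, ?_, ?_, ?_⟩
    · rintro _ ⟨f, -, rfl⟩
      exact ⟨(hS.le_friedrichs hF).1 f.2, trivial⟩
    · have h1 : (M.comap (redMap S Sk)).map (redMap S Sk) = M := by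
        rw [Submodule.map_comap_eq]
        refine inf_eq_right.2 fun u hu => ?_
        exact redMap_surj hS hK u (hM hu).1 (hM hu).2
      rw [← hMj, ← (Submodule.equivMapOfInjective _ S.domain.injective_subtype
        (M.comap (redMap S Sk))).finrank_eq,
        (Submodule.equivMapOfInjective _ (redMap_injective hS hK)
        (M.comap (redMap S Sk))).finrank_eq, h1]
    · rintro _ ⟨f, hf, rfl⟩ hu
      have h1 : S f = Sf ⟨f, hu⟩ := (hS.le_friedrichs hF).2 rfl
      have h2 := hform f hf
      rw [h1] at h2
      have h3 : ‖redMap S Sk f‖ ≤ ‖(f : H)‖ := Submodule.norm_starProjection_apply_le _ _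
      refine h2.trans ?_
      show c * ‖redMap S Sk f‖ ^ 2 ≤ c * ‖(f : H)‖ ^ 2
      gcongr
  have hne := krein_nonempty hS hK (not_finite_domain hS hdef) j
  exact ⟨le_csInf (hne.mono hsub) hFlow, csInf_le_csInf ⟨ε, hFlow⟩ hne hsub⟩
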